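/- (Calderón–Zygmund decomposition for the dyadic Hausdorff content.) Let d ≥ 1, β ∈ (0,d], let Q ⊂ ℝ^d be a finite cube, and let f ∈ L¹(Q; 𝓗^{β,Q}_∞). Then for every λ > 0 with λ ≥ l(Q)^{-β} ∫_Q |f| d𝓗^{β,Q}_∞, there exists a countable collection {Q_k} of pairwise non-overlapping cubes of 𝓓(Q) contained in Q such that: (1) for each k, λ < l(Q_k)^{-β} ∫_{Q_k} |f| d𝓗^{β,Q}_∞ ≤ 2^β λ; and (2) |f(x)| ≤ λ for 𝓗^β-almost every x ∈ Q \ ∪_k Q_k, where 𝓗^β is the β-dimensional Hausdorff measure. -/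

import Mathlib

open Set MeasureTheory ENNReal NNReal Filter

noncomputable section

/-- `ℝ^d` with the Euclidean metric. -/
abbrev Euc (d : ℕ) : Type := EuclideanSpace ℝ (Fin d)

/-- An axis-parallel cube in `ℝ^d`, given by its lower corner and (positive) side length. -/
structure Cube (d : ℕ) where
  corner : Fin d → ℝ
  side : ℝ
  side_pos : 0 < side

namespace Cube

/-- The (half-open) set of points of the cube. -/
def set {d : ℕ} (Q : Cube d) : Set (Euc d) :=
  {x : Euc d | ∀ i, Q.corner i ≤ x i ∧ x i < Q.corner i + Q.side}

/-- The dyadic lattice `𝓓(Q)` generated by `Q`: all cubes of side `l(Q)·2ⁿ` (`n : ℤ`) with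
corners on the correspondingly rescaled grid anchored at the corner of `Q`; equivalently `Q`,
its dyadic ancestors, and all of their repeated dyadic subdivisions. -/
def dyadic {d : ℕ} (Q : Cube d) : Set (Cube d) :=
  {Q' | ∃ (n : ℤ) (k : Fin d → ℤ), Q'.side = Q.side * 2 ^ n ∧
    ∀ i, Q'.corner i = Q.corner i + (k i : ℝ) * (Q.side * 2 ^ n)}

end Cube

/-- The spherical Hausdorff content `𝓗^β_∞`, with `ω_β = π^{β/2}/Γ(β/2+1)`. -/
def hausdorffContent (d : ℕ) (β : ℝ) (E : Set (Euc d)) : ℝ≥0∞ :=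
  ⨅ (c : ℕ → Euc d × ℝ) (_ : E ⊆ ⋃ i, Metric.ball (c i).1 (c i).2),
    ∑' i, ENNReal.ofReal (Real.pi ^ (β / 2) / Real.Gamma (β / 2 + 1) * (c i).2 ^ β)

/-- The dyadic Hausdorff content `𝓗^{β,Q}_∞` adapted to the cube `Q`. -/
def dyadicContent (d : ℕ) (β : ℝ) (Q : Cube d) (E : Set (Euc d)) : ℝ≥0∞ :=
  ⨅ (c : ℕ → Cube d) (_ : ∀ i, c i ∈ Q.dyadic) (_ : E ⊆ ⋃ i, (c i).set),
    ∑' i, ENNReal.ofReal ((c i).side ^ β)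

/-- The Choquet integral `∫_A f dH := ∫_0^∞ H({x ∈ A : f x > t}) dt`. -/
def choquetIntegral {X : Type*} (H : Set X → ℝ≥0∞) (A : Set X) (f : X → ℝ) : ℝ≥0∞ :=
  ∫⁻ t in Set.Ioi (0 : ℝ), H {x | x ∈ A ∧ t < f x}

/-- `f` is `H`-quasicontinuous: for every `ε > 0` there is an open set `O` with `H O < ε`
such that `f` restricted to `Oᶜ` is continuous. -/
def QuasiContinuous {X : Type*} [TopologicalSpace X] (H : Set X → ℝ≥0∞) (f : X → ℝ) : Prop :=
  ∀ ε : ℝ, 0 < ε → ∃ O : Set X, IsOpen O ∧ H O < ENNReal.ofReal ε ∧ ContinuousOn f Oᶜ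

/-- `f ∈ L¹(A; H)`: `f` is `H`-quasicontinuous and `∫_A |f| dH < ∞`. -/
def MemChoquetL1 {X : Type*} [TopologicalSpace X] (H : Set X → ℝ≥0∞) (A : Set X)
    (f : X → ℝ) : Prop :=
  QuasiContinuous H f ∧ choquetIntegral H A (fun x => |f x|) < ⊤

/-- The `BMO^β(Q₀)` seminorm: `sup_{Q ⊆ Q₀} inf_{c ∈ ℝ} l(Q)^{-β} ∫_Q |u - c| d𝓗^β_∞`. -/
def bmoSeminorm (d : ℕ) (β : ℝ) (Q₀ : Set (Euc d)) (u : Euc d → ℝ) : ℝ≥0∞ :=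
  ⨆ (Q : Cube d) (_ : Q.set ⊆ Q₀),
    ⨅ c : ℝ, choquetIntegral (hausdorffContent d β) Q.set (fun x => |u x - c|) /
      ENNReal.ofReal (Q.side ^ β)

/-- Membership in `BMO^β(Q₀)`. -/
def MemBMO (d : ℕ) (β : ℝ) (Q₀ : Set (Euc d)) (u : Euc d → ℝ) : Prop :=
  MemChoquetL1 (hausdorffContent d β) Q₀ u ∧ bmoSeminorm d β Q₀ u < ⊤


/-- The classical John–Nirenberg BMO seminorm on `Q₀` with respect to Lebesgue measure. -/
def bmoClassical (d : ℕ) (Q₀ : Set (Euc d)) (u : Euc d → ℝ) : ℝ≥0∞ :=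
  ⨆ (Q : Cube d) (_ : Q.set ⊆ Q₀),
    (volume Q.set)⁻¹ * ∫⁻ x in Q.set, ENNReal.ofReal |u x - ⨍ y in Q.set, u y|

/-- The axis-parallel affine subspace of `ℝ^d` obtained by freeing the coordinates in `S`
and fixing the remaining coordinates to the values of `b`. -/
def hyperplane (d : ℕ) (S : Finset (Fin d)) (b : Fin d → ℝ) : Set (Euc d) :=
  {x : Euc d | ∀ i ∉ S, x i = b i}

/-- The classical BMO seminorm of `u` on `Q₀ ∩ H` with respect to the `k`-dimensional
Hausdorff measure `𝓗^k`, the supremum being over the subcubes `Q.set ∩ H ⊆ Q₀ ∩ H`. -/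
def bmoClassicalOnPlane (d k : ℕ) (Q₀ : Cube d) (H : Set (Euc d)) (u : Euc d → ℝ) : ℝ≥0∞ :=
  ⨆ (Q : Cube d) (_ : Q.set ∩ H ⊆ Q₀.set),
    (Measure.hausdorffMeasure (k : ℝ) (Q.set ∩ H))⁻¹ *
      ∫⁻ x in Q.set ∩ H,
        ENNReal.ofReal |u x - ⨍ y in Q.set ∩ H, u y ∂(Measure.hausdorffMeasure (k : ℝ))|
          ∂(Measure.hausdorffMeasure (k : ℝ))

/-- The unique dyadic cube of `𝓓(Q)` of generation `n` (side `l(Q)·2^{-n}`) containing `x`. -/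
def dyadicCubeAt {d : ℕ} (Q : Cube d) (n : ℕ) (x : Euc d) : Cube d where
  corner := fun i => Q.corner i + Q.side * (2 : ℝ)⁻¹ ^ n *
    (⌊(x i - Q.corner i) / (Q.side * (2 : ℝ)⁻¹ ^ n)⌋ : ℝ)
  side := Q.side * (2 : ℝ)⁻¹ ^ n
  side_pos := by have := Q.side_pos; positivity

/-- The dyadic `β`-Hausdorff maximal function associated to `𝓗^{β,Q}_∞`. -/
def dyadicMaximal (d : ℕ) (β : ℝ) (Q : Cube d) (f : Euc d → ℝ) (x : Euc d) : ℝ≥0∞ :=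
  ⨆ (Q' : Cube d) (_ : Q' ∈ Q.dyadic) (_ : x ∈ Q'.set),
    choquetIntegral (dyadicContent d β Q) Q'.set (fun y => |f y|) / ENNReal.ofReal (Q'.side ^ β)

/-- The `BMO^{β,p}(Q₀)` seminorm. -/
def bmoSeminormP (d : ℕ) (β p : ℝ) (Q₀ : Set (Euc d)) (u : Euc d → ℝ) : ℝ≥0∞ :=
  ⨆ (Q : Cube d) (_ : Q.set ⊆ Q₀),
    ⨅ c : ℝ, (choquetIntegral (hausdorffContent d β) Q.set (fun x => |u x - c| ^ p) /
      ENNReal.ofReal (Q.side ^ β)) ^ (1 / p)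

/-- The standard normalization constant `γ(α) = π^{d/2} 2^α Γ(α/2) / Γ((d-α)/2)`. -/
def rieszConst (d : ℕ) (α : ℝ) : ℝ :=
  Real.pi ^ ((d : ℝ) / 2) * 2 ^ α * Real.Gamma (α / 2) / Real.Gamma (((d : ℝ) - α) / 2)

/-- The Riesz potential `I_α μ (x) = γ(α)⁻¹ ∫ |x - y|^{α - d} dμ(y)`. -/
def rieszPotential (d : ℕ) (α : ℝ) (μ : Measure (Euc d)) (x : Euc d) : ℝ :=
  (rieszConst d α)⁻¹ * (∫⁻ y, ENNReal.ofReal (‖x - y‖ ^ (α - (d : ℝ))) ∂μ).toReal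

/-- The Morrey norm `‖μ‖_{ℳ^γ} = sup_{x, r>0} μ(B(x,r))/r^γ`. -/
def morreyNorm (d : ℕ) (γ : ℝ) (μ : Measure (Euc d)) : ℝ≥0∞ :=
  ⨆ (x : Euc d) (r : ℝ) (_ : 0 < r), μ (Metric.ball x r) / ENNReal.ofReal (r ^ γ)

/-- The dyadic `BMO^β_*(Q₀)` seminorm, where for each subcube `Q` the dyadic Hausdorff
content adapted to that `Q` is used. -/
def bmoDyadicSeminorm (d : ℕ) (β : ℝ) (Q₀ : Set (Euc d)) (u : Euc d → ℝ) : ℝ≥0∞ :=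
  ⨆ (Q : Cube d) (_ : Q.set ⊆ Q₀),
    ⨅ c : ℝ, choquetIntegral (dyadicContent d β Q) Q.set (fun x => |u x - c|) /
      ENNReal.ofReal (Q.side ^ β)

/-- A (possibly infinite) cube in `ℝ^d`: either a finite cube, or a product of intervals
which are infinite in every coordinate direction. -/
def IsGenCube (d : ℕ) (S : Set (Euc d)) : Prop :=
  (∃ Q : Cube d, S = Q.set) ∨
  (∃ I : Fin d → Set ℝ,
      (∀ i, (∃ a, I i = Set.Ici a) ∨ (∃ b, I i = Set.Iio b) ∨ I i = Set.univ) ∧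
      S = {x : Euc d | ∀ i, x i ∈ I i})

/-- The Choquet integral of an `ℝ≥0∞`-valued function. -/
def choquetIntegralE {X : Type*} (H : Set X → ℝ≥0∞) (f : X → ℝ≥0∞) : ℝ≥0∞ :=
  ∫⁻ t in Set.Ioi (0 : ℝ), H {x | ENNReal.ofReal t < f x}

namespace Cube

variable {d : ℕ}

/-- The lower corner of a cube as a point of Euclidean space. -/
def cornerPoint (q : Cube d) : Euc d := WithLp.toLp 2 q.corner

lemma cornerPoint_mem (q : Cube d) : q.cornerPoint ∈ q.set := fun _ =>
  ⟨le_refl _, lt_add_of_pos_right _ q.side_pos⟩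

lemma self_mem_dyadic (Q : Cube d) : Q ∈ Q.dyadic :=
  ⟨0, 0, by simp, by simp⟩

lemma countable_dyadic (Q : Cube d) : Q.dyadic.Countable := by
  have hpos : ∀ n : ℤ, 0 < Q.side * 2 ^ n := fun n => by have := Q.side_pos; positivity
  refine (countable_range fun p : ℤ × (Fin d → ℤ) =>
    (⟨fun i => Q.corner i + (p.2 i : ℝ) * (Q.side * 2 ^ p.1), Q.side * 2 ^ p.1,
      hpos p.1⟩ : Cube d)).mono ?_
  rintro ⟨c, s, hs⟩ ⟨n, k, hn, hk⟩
  refine ⟨(n, k), ?_⟩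
  simp only at hn hk
  simp only [mk.injEq]
  exact ⟨(funext hk).symm, hn.symm⟩

lemma eq_of_side_eq_of_set_eq {q₁ q₂ : Cube d} (hs : q₁.side = q₂.side)
    (h : q₁.set = q₂.set) : q₁ = q₂ := by
  have h₁ : q₁.cornerPoint ∈ q₂.set := h ▸ q₁.cornerPoint_mem
  have h₂ : q₂.cornerPoint ∈ q₁.set := h ▸ q₂.cornerPoint_mem
  have hc : q₁.corner = q₂.corner := funext fun i => le_antisymm (h₂ i).1 (h₁ i).1
  cases q₁; cases q₂; simp_all

/-- Two dyadic cubes sharing a point are nested. -/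
lemma set_subset_of_side_le {Q q₁ q₂ : Cube d} (h₁ : q₁ ∈ Q.dyadic) (h₂ : q₂ ∈ Q.dyadic)
    (hs : q₁.side ≤ q₂.side) {x : Euc d} (hx₁ : x ∈ q₁.set) (hx₂ : x ∈ q₂.set) :
    q₁.set ⊆ q₂.set := by
  obtain ⟨n₁, k₁, hn₁, hk₁⟩ := h₁
  obtain ⟨n₂, k₂, hn₂, hk₂⟩ := h₂
  have hQ := Q.side_pos
  have hn : n₁ ≤ n₂ := by
    rw [hn₁, hn₂] at hs
    exact (zpow_le_zpow_iff_right₀ _root_.one_lt_two).1 (le_of_mul_le_mul_left hs hQ)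
  obtain ⟨m, rfl⟩ := Int.le.dest hn
  set t : ℝ := Q.side * 2 ^ n₁ with ht
  have htpos : 0 < t := by positivity
  have ht₂ : Q.side * 2 ^ (n₁ + (m : ℤ)) = 2 ^ m * t := by
    rw [zpow_add₀ two_ne_zero, zpow_natCast, ht]; ring
  intro y hy i
  have a := hx₁ i
  have b := hx₂ i
  have c := hy i
  rw [hn₁, hk₁] at a c
  rw [hn₂, hk₂, ht₂] at b ⊢
  have e₁ : k₂ i * 2 ^ m < k₁ i + 1 := by
    have : ((k₂ i : ℝ) * 2 ^ m) * t < (k₁ i + 1) * t := by linarith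
    exact_mod_cast lt_of_mul_lt_mul_right this htpos.le
  have e₂ : k₁ i < (k₂ i + 1) * 2 ^ m := by
    have : (k₁ i : ℝ) * t < ((k₂ i + 1) * 2 ^ m) * t := by linarith
    exact_mod_cast lt_of_mul_lt_mul_right this htpos.le
  have f₁ : ((k₂ i : ℝ) * 2 ^ m) * t ≤ k₁ i * t :=
    mul_le_mul_of_nonneg_right (by exact_mod_cast Int.lt_add_one_iff.1 e₁) htpos.le
  have f₂ : ((k₁ i : ℝ) + 1) * t ≤ ((k₂ i + 1) * 2 ^ m) * t :=
    mul_le_mul_of_nonneg_right (by exact_mod_cast e₂) htpos.le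
  constructor <;> linarith

/-- The dyadic parent of a dyadic cube. -/
lemma exists_parent {Q q : Cube d} (hq : q ∈ Q.dyadic) :
    ∃ p ∈ Q.dyadic, p.side = 2 * q.side ∧ q.set ⊆ p.set := by
  obtain ⟨n, k, hn, hk⟩ := hq
  have hpos : 0 < Q.side * 2 ^ (n + 1) := by have := Q.side_pos; positivity
  let p : Cube d := ⟨fun i => Q.corner i + ((k i / 2 : ℤ) : ℝ) * (Q.side * 2 ^ (n + 1)),
    Q.side * 2 ^ (n + 1), hpos⟩
  have hp : p ∈ Q.dyadic := ⟨n + 1, fun i => k i / 2, rfl, fun _ => rfl⟩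
  have hside : p.side = 2 * q.side := by
    change Q.side * 2 ^ (n + 1) = _
    rw [hn, zpow_add₀ two_ne_zero]; ring
  refine ⟨p, hp, hside, set_subset_of_side_le ⟨n, k, hn, hk⟩ hp (by linarith [q.side_pos])
    q.cornerPoint_mem fun i => ?_⟩
  have e : p.corner i = Q.corner i + ((k i / 2 : ℤ) : ℝ) * (2 * q.side) := by
    rw [← hside]
  change p.corner i ≤ q.corner i ∧ q.corner i < p.corner i + p.side
  rw [e, hside, hk i, ← hn]
  have a : ((k i / 2 : ℤ) : ℝ) * 2 ≤ k i := by
    exact_mod_cast Int.ediv_mul_le (k i) two_ne_zero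
  have b : (k i : ℝ) < ((k i / 2 : ℤ) + 1) * 2 := by
    exact_mod_cast Int.lt_ediv_add_one_mul_self (k i) zero_lt_two
  constructor <;> nlinarith [q.side_pos]

/-- The maximal cubes of a family of dyadic cubes of bounded size. -/
lemma exists_maximal_subfamily {Q : Cube d} {P : Set (Cube d)} (hP : P ⊆ Q.dyadic)
    (hb : ∀ q ∈ P, q.side ≤ Q.side) :
    ∃ M ⊆ P, (∀ q ∈ P, ∃ q' ∈ M, q.set ⊆ q'.set) ∧ M.PairwiseDisjoint set ∧
      ∀ q ∈ M, ∀ q' ∈ P, q.set ⊆ q'.set → q'.side ≤ q.side := by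
  refine ⟨{q ∈ P | ∀ q' ∈ P, q.set ⊆ q'.set → q'.side ≤ q.side}, fun q hq => hq.1, ?_, ?_,
    fun q hq => hq.2⟩
  · intro q hq
    obtain ⟨n, ⟨q', hq', hqq', hn⟩, hmax⟩ := Int.exists_greatest_of_bdd
      (P := fun n => ∃ q' ∈ P, q.set ⊆ q'.set ∧ q'.side = Q.side * 2 ^ n)
      ⟨0, by
        rintro n ⟨q', hq', -, hn⟩
        have := hb q' hq'
        rw [hn] at this
        have h1 : (2 : ℝ) ^ n ≤ 2 ^ (0 : ℤ) := by
          rw [zpow_zero]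
          exact (mul_le_iff_le_one_right Q.side_pos).1 this
        exact (zpow_le_zpow_iff_right₀ _root_.one_lt_two).1 h1⟩
      (by
        obtain ⟨n, k, hn, -⟩ := hP hq
        exact ⟨n, q, hq, Subset.rfl, hn⟩)
    refine ⟨q', ⟨hq', fun p hp hpq => ?_⟩, hqq'⟩
    obtain ⟨m, k, hm, -⟩ := hP hp
    have := hmax m ⟨p, hp, hqq'.trans hpq, hm⟩
    rw [hm, hn]
    exact mul_le_mul_of_nonneg_left (zpow_le_zpow_right₀ one_le_two this) Q.side_pos.le
  · intro q₁ h₁ q₂ h₂ hne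
    by_contra hnd
    obtain ⟨x, hx₁, hx₂⟩ := not_disjoint_iff.1 hnd
    have key : ∀ a ∈ P, (∀ q' ∈ P, a.set ⊆ q'.set → q'.side ≤ a.side) → ∀ b ∈ P,
        a.side ≤ b.side → x ∈ a.set → x ∈ b.set → a = b := by
      intro a ha hmax b hb hab hxa hxb
      have hsub := set_subset_of_side_le (hP ha) (hP hb) hab hxa hxb
      have hba := hmax b hb hsub
      exact eq_of_side_eq_of_set_eq (hab.antisymm hba)
        (hsub.antisymm (set_subset_of_side_le (hP hb) (hP ha) hba hxb hxa))
    rcases le_total q₁.side q₂.side with h | h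
    · exact hne (key q₁ h₁.1 h₁.2 q₂ h₂.1 h hx₁ hx₂)
    · exact hne (key q₂ h₂.1 h₂.2 q₁ h₁.1 h hx₂ hx₁).symm

lemma dist_le_of_mem {q : Cube d} {x y : Euc d} (hx : x ∈ q.set) (hy : y ∈ q.set) :
    dist x y ≤ √d * q.side := by
  rw [EuclideanSpace.dist_eq, ← Real.sqrt_sq q.side_pos.le, ← Real.sqrt_mul (Nat.cast_nonneg d)]
  refine Real.sqrt_le_sqrt ?_
  calc ∑ i, dist (x i) (y i) ^ 2 ≤ ∑ _i : Fin d, q.side ^ 2 := by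
        refine Finset.sum_le_sum fun i _ => ?_
        have a := hx i
        have b := hy i
        refine pow_le_pow_left₀ dist_nonneg ?_ 2
        rw [Real.dist_eq, abs_le]
        constructor <;> linarith
    _ = d * q.side ^ 2 := by simp

lemma volume_set (q : Cube d) : volume q.set = ENNReal.ofReal (q.side ^ d) := by
  have h : q.set = (WithLp.ofLp : Euc d → Fin d → ℝ) ⁻¹'
      (pi univ fun i => Ico (q.corner i) (q.corner i + q.side)) := by
    ext x; simp [Cube.set]
  rw [h, (PiLp.volume_preserving_ofLp (Fin d)).measure_preimage
    (MeasurableSet.univ_pi fun _ => measurableSet_Ico).nullMeasurableSet, Real.volume_pi_Ico]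
  simp [ENNReal.ofReal_pow q.side_pos.le]

/-- A cube is an optimal cover of itself by cubes, for exponents at most the dimension. -/
lemma ofReal_side_rpow_le_tsum {β : ℝ} (hβ : 0 ≤ β) (hβd : β ≤ d) (q : Cube d)
    {C : Set (Cube d)} (hC : C.Countable) (hq : q.set ⊆ ⋃ c ∈ C, c.set) :
    ENNReal.ofReal (q.side ^ β) ≤ ∑' c : C, ENNReal.ofReal (c.1.side ^ β) := by
  by_cases hbig : ∃ c ∈ C, q.side ≤ c.side
  · obtain ⟨c, hc, hqc⟩ := hbig
    exact (ENNReal.ofReal_le_ofReal (Real.rpow_le_rpow q.side_pos.le hqc hβ)).trans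
      (ENNReal.le_tsum (f := fun c : C => ENNReal.ofReal (c.1.side ^ β)) ⟨c, hc⟩)
  push Not at hbig
  have hsplit : ∀ c : Cube d, c.side ^ d = c.side ^ ((d : ℝ) - β) * c.side ^ β := fun c => by
    rw [← Real.rpow_add c.side_pos, sub_add_cancel, Real.rpow_natCast]
  have hpos : 0 < q.side ^ ((d : ℝ) - β) := Real.rpow_pos_of_pos q.side_pos _
  have hmul : ENNReal.ofReal (q.side ^ ((d : ℝ) - β)) * ENNReal.ofReal (q.side ^ β) ≤
      ENNReal.ofReal (q.side ^ ((d : ℝ) - β)) *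
        ∑' c : C, ENNReal.ofReal (c.1.side ^ β) := by
    rw [← ENNReal.ofReal_mul hpos.le, ← hsplit, ← volume_set, ← ENNReal.tsum_mul_left]
    refine (measure_mono hq).trans ((measure_biUnion_le _ hC _).trans
      (ENNReal.tsum_le_tsum fun c => ?_))
    rw [volume_set, hsplit, ← ENNReal.ofReal_mul hpos.le]
    refine ENNReal.ofReal_le_ofReal (mul_le_mul_of_nonneg_right ?_
      (Real.rpow_nonneg c.1.side_pos.le _))
    exact Real.rpow_le_rpow c.1.side_pos.le (hbig c c.2).le (sub_nonneg.2 hβd)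
  exact (ENNReal.mul_le_mul_iff_right (by simpa using hpos) ENNReal.ofReal_ne_top).1 hmul

lemma ediam_set_le (q : Cube d) : Metric.ediam q.set ≤ ENNReal.ofReal (√d * q.side) :=
  Metric.ediam_le fun _ hx _ hy => by
    rw [edist_dist]
    exact ENNReal.ofReal_le_ofReal (dist_le_of_mem hx hy)

/-- Sets with covers by cubes of arbitrarily small total cost are Hausdorff null. -/
lemma hausdorffMeasure_eq_zero {β : ℝ} (hβ : 0 < β) {E : Set (Euc d)}
    (h : ∀ δ : ℝ, 0 < δ → ∃ C : Set (Cube d), C.Countable ∧ E ⊆ ⋃ c ∈ C, c.set ∧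
      ∑' c : C, ENNReal.ofReal (c.1.side ^ β) ≤ ENNReal.ofReal δ) :
    Measure.hausdorffMeasure β E = 0 := by
  choose C hC hEC hsum using fun n : ℕ => h (1 / ((n : ℝ) + 1)) (by positivity)
  have hcount : ∀ n, Countable (C n) := fun n => (hC n).to_subtype
  set K : ℝ≥0∞ := ENNReal.ofReal ((√d) ^ β) with hK
  have hdiam : ∀ q : Cube d, Metric.ediam q.set ^ β ≤ K * ENNReal.ofReal (q.side ^ β) := by
    intro q
    rw [hK, ← ENNReal.ofReal_mul (by positivity), ← Real.mul_rpow (by positivity) q.side_pos.le,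
      ← ENNReal.ofReal_rpow_of_nonneg (by have := q.side_pos; positivity) hβ.le]
    exact ENNReal.rpow_le_rpow q.ediam_set_le hβ.le
  have hlim : Tendsto (fun n : ℕ => K * ENNReal.ofReal (1 / ((n : ℝ) + 1))) atTop (nhds 0) := by
    have := ENNReal.Tendsto.const_mul (a := K)
      (ENNReal.tendsto_ofReal (tendsto_one_div_add_atTop_nhds_zero_nat (𝕜 := ℝ)))
      (Or.inr ENNReal.ofReal_ne_top)
    simpa using this
  have htsum : ∀ n, ∑' c : C n, Metric.ediam c.1.set ^ β ≤
      K * ENNReal.ofReal (1 / ((n : ℝ) + 1)) := fun n =>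
    (ENNReal.tsum_le_tsum fun c : C n => hdiam c.1).trans
      (ENNReal.tsum_mul_left.trans_le (mul_le_mul_right (hsum n) K))
  have hle := Measure.hausdorffMeasure_le_liminf_tsum (X := Euc d) (ι := fun n => C n) β E
    (l := atTop) (fun n : ℕ => (K * ENNReal.ofReal (1 / ((n : ℝ) + 1))) ^ β⁻¹)
    (by simpa [ENNReal.zero_rpow_of_pos (inv_pos.2 hβ)] using hlim.ennrpow_const β⁻¹)
    (fun n c => c.1.set)
    (Eventually.of_forall fun n c => by
      rw [ENNReal.le_rpow_inv_iff hβ]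
      exact (ENNReal.le_tsum (f := fun c : C n => Metric.ediam c.1.set ^ β) c).trans (htsum n))
    (Eventually.of_forall fun n => by simpa only [iUnion_coe_set] using hEC n)
  refine le_antisymm (hle.trans ?_) zero_le
  rw [← hlim.liminf_eq]
  exact liminf_le_liminf (Eventually.of_forall htsum)

lemma dyadicCubeAt_mem_dyadic (Q : Cube d) (n : ℕ) (x : Euc d) :
    dyadicCubeAt Q n x ∈ Q.dyadic := by
  refine ⟨-n, fun i => ⌊(x i - Q.corner i) / (Q.side * (2 : ℝ)⁻¹ ^ n)⌋, ?_, fun i => ?_⟩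
  · simp [dyadicCubeAt]
  · simp [dyadicCubeAt, mul_comm]

lemma mem_dyadicCubeAt (Q : Cube d) (n : ℕ) (x : Euc d) : x ∈ (dyadicCubeAt Q n x).set := by
  intro i
  have hs : 0 < Q.side * (2 : ℝ)⁻¹ ^ n := by have := Q.side_pos; positivity
  have a := Int.floor_le ((x i - Q.corner i) / (Q.side * (2 : ℝ)⁻¹ ^ n))
  have b := Int.lt_floor_add_one ((x i - Q.corner i) / (Q.side * (2 : ℝ)⁻¹ ^ n))
  rw [le_div_iff₀ hs] at a
  rw [div_lt_iff₀ hs] at b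
  simp only [dyadicCubeAt]
  constructor <;> linarith

/-- Every point lies in dyadic cubes of arbitrarily small diameter. -/
lemma exists_dyadic_subset_ball (Q : Cube d) (x : Euc d) {r : ℝ} (hr : 0 < r) :
    ∃ q ∈ Q.dyadic, q.side ≤ Q.side ∧ x ∈ q.set ∧ q.set ⊆ Metric.ball x r := by
  have hlim : Tendsto (fun n : ℕ => √d * (Q.side * (2 : ℝ)⁻¹ ^ n)) atTop (nhds 0) := by
    simpa using ((tendsto_pow_atTop_nhds_zero_of_lt_one (r := (2 : ℝ)⁻¹) (by norm_num)
      (by norm_num)).const_mul Q.side).const_mul √(d : ℝ)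
  obtain ⟨n, hn⟩ := (hlim.eventually_lt_const hr).exists
  refine ⟨dyadicCubeAt Q n x, dyadicCubeAt_mem_dyadic Q n x, ?_, mem_dyadicCubeAt Q n x,
    fun y hy => (dist_le_of_mem hy (mem_dyadicCubeAt Q n x)).trans_lt hn⟩
  exact mul_le_of_le_one_right Q.side_pos.le (pow_le_one₀ (by norm_num) (by norm_num))

end Cube

section ContentIntegral

variable {d : ℕ} {β : ℝ} {Q : Cube d}

lemma dyadicContent_mono {A B : Set (Euc d)} (h : A ⊆ B) :
    dyadicContent d β Q A ≤ dyadicContent d β Q B :=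
  iInf_mono fun _ => iInf_mono fun _ => iInf_mono' fun hB => ⟨h.trans hB, le_rfl⟩

lemma exists_cover_of_dyadicContent_lt {A : Set (Euc d)} {a : ℝ≥0∞}
    (h : dyadicContent d β Q A < a) :
    ∃ C ⊆ Q.dyadic, A ⊆ ⋃ c ∈ C, c.set ∧ ∑' c : C, ENNReal.ofReal (c.1.side ^ β) < a := by
  simp only [dyadicContent, iInf_lt_iff] at h
  obtain ⟨c, hc, hA, hlt⟩ := h
  refine ⟨range c, range_subset_iff.2 hc, by simpa using hA, lt_of_le_of_lt ?_ hlt⟩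
  have hinj : Function.Injective fun q : range c => q.2.choose := fun q₁ q₂ h => by
    have h' : c q₁.2.choose = c q₂.2.choose := congrArg c h
    rw [q₁.2.choose_spec, q₂.2.choose_spec] at h'
    exact Subtype.ext h'
  refine le_trans (le_of_eq (tsum_congr fun q => ?_))
    (ENNReal.tsum_comp_le_tsum_of_injective hinj fun i => ENNReal.ofReal ((c i).side ^ β))
  rw [q.2.choose_spec]

lemma choquetIntegral_dyadicContent_mono {A B : Set (Euc d)} (h : A ⊆ B) (g : Euc d → ℝ) :
    choquetIntegral (dyadicContent d β Q) A g ≤ choquetIntegral (dyadicContent d β Q) B g :=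
  lintegral_mono fun _ => dyadicContent_mono fun _ hx => ⟨h hx.1, hx.2⟩

/-- Chebyshev's inequality for the Choquet integral. -/
lemma mul_dyadicContent_le_choquetIntegral {A B : Set (Euc d)} {g : Euc d → ℝ} {s : ℝ}
    (hAB : A ⊆ B) (hs : ∀ x ∈ A, s < g x) :
    ENNReal.ofReal s * dyadicContent d β Q A ≤ choquetIntegral (dyadicContent d β Q) B g := by
  calc ENNReal.ofReal s * dyadicContent d β Q A
      = ∫⁻ _t in Ioo (0 : ℝ) s, dyadicContent d β Q A := by
        rw [setLIntegral_const, Real.volume_Ioo, sub_zero, mul_comm]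
    _ ≤ ∫⁻ t in Ioo (0 : ℝ) s, dyadicContent d β Q {x | x ∈ B ∧ t < g x} :=
        setLIntegral_mono' measurableSet_Ioo fun t ht =>
          dyadicContent_mono fun x hx => ⟨hAB hx, ht.2.trans (hs x hx)⟩
    _ ≤ choquetIntegral (dyadicContent d β Q) B g :=
        lintegral_mono_set fun t ht => ht.1

/-- If the averages over all small dyadic cubes meeting `E` are at most `lam`, and a
quasicontinuous `f` exceeds `s > lam` on `E`, then `E` is Hausdorff null. -/
lemma hausdorffMeasure_eq_zero_of_choquetIntegral_le (hβ : 0 < β) (hβd : β ≤ d)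
    {f : Euc d → ℝ} (hf : QuasiContinuous (dyadicContent d β Q) f) {E : Set (Euc d)}
    {lam s : ℝ} (hlam : 0 < lam) (hs : lam < s) (hE : ∀ x ∈ E, s < |f x|)
    (hI : ∀ q ∈ Q.dyadic, q.side ≤ Q.side → (q.set ∩ E).Nonempty →
      choquetIntegral (dyadicContent d β Q) q.set (fun x => |f x|) ≤
        ENNReal.ofReal lam * ENNReal.ofReal (q.side ^ β)) :
    Measure.hausdorffMeasure β E = 0 := by
  obtain ⟨u, hlu, hus⟩ := exists_between hs
  have hs0 : 0 < s := hlam.trans hs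
  set θ : ℝ := u / s with hθ
  have hθ0 : 0 < θ := div_pos (hlam.trans hlu) hs0
  have hθ1 : θ < 1 := (div_lt_one hs0).2 hus
  refine Cube.hausdorffMeasure_eq_zero hβ fun δ hδ => ?_
  obtain ⟨O, hO, hHO, hcont⟩ := hf ((1 - θ) * δ / 2) (by have := sub_pos.2 hθ1; positivity)
  obtain ⟨C, hCQ, hOC, hCsum⟩ := exists_cover_of_dyadicContent_lt hHO
  have hCc : C.Countable := Q.countable_dyadic.mono hCQ
  set w : Cube d → ℝ≥0∞ := fun c => ENNReal.ofReal (c.side ^ β) with hw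
  let P : Set (Cube d) := {q | q ∈ Q.dyadic ∧ q.side ≤ Q.side ∧
    ENNReal.ofReal (1 - θ) * w q ≤ ∑' c : {c ∈ C | c.set ⊆ q.set}, w c}
  obtain ⟨G, hGP, hGcov, hGdisj, -⟩ := Cube.exists_maximal_subfamily (Q := Q) (P := P)
    (fun q hq => hq.1) (fun q hq => hq.2.1)
  have hGsum : ENNReal.ofReal (1 - θ) * ∑' q : G, w q ≤ ∑' c : C, w c := by
    rw [← ENNReal.tsum_mul_left]
    refine (ENNReal.tsum_le_tsum fun q : G => (hGP q.2).2.2).trans ?_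
    rw [← ENNReal.tsum_biUnion' (t := fun q : Cube d => {c ∈ C | c.set ⊆ q.set})]
    · exact ENNReal.tsum_mono_subtype w (iUnion₂_subset fun q _ c hc => hc.1)
    · intro q₁ h₁ q₂ h₂ hne
      refine disjoint_left.2 fun c hc₁ hc₂ => ?_
      exact disjoint_left.1 (hGdisj h₁ h₂ hne) (hc₁.2 c.cornerPoint_mem)
        (hc₂.2 c.cornerPoint_mem)
  refine ⟨C ∪ G, hCc.union (Q.countable_dyadic.mono fun q hq => (hGP hq).1), ?_, ?_⟩
  · intro x hx
    rw [biUnion_union]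
    by_cases hxC : x ∈ ⋃ c ∈ C, c.set
    · exact Or.inl hxC
    refine Or.inr ?_
    have hxO : x ∈ Oᶜ := fun h => hxC (hOC h)
    have hnhds : {y | s < |f y|} ∈ nhdsWithin x Oᶜ :=
      (hcont x hxO).abs.eventually_const_lt (hE x hx)
    obtain ⟨r, hr, hball⟩ := Metric.mem_nhdsWithin_iff.1 hnhds
    obtain ⟨q, hq, hqs, hxq, hqr⟩ := Q.exists_dyadic_subset_ball x hr
    suffices hqP : q ∈ P by
      obtain ⟨p, hp, hqp⟩ := hGcov q hqP
      exact mem_biUnion hp (hqp hxq)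
    refine ⟨hq, hqs, ?_⟩
    have hside : 0 < q.side ^ β := Real.rpow_pos_of_pos q.side_pos _
    have hsmall : dyadicContent d β Q (q.set \ O) < ENNReal.ofReal θ * w q := by
      have h₁ : ENNReal.ofReal s * dyadicContent d β Q (q.set \ O) ≤
          ENNReal.ofReal lam * w q :=
        (mul_dyadicContent_le_choquetIntegral sdiff_subset
          fun y hy => hball ⟨hqr hy.1, hy.2⟩).trans (hI q hq hqs ⟨x, hxq, hx⟩)
      have h₂ : ENNReal.ofReal lam * w q < ENNReal.ofReal s * (ENNReal.ofReal θ * w q) := by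
        rw [← mul_assoc, ← ENNReal.ofReal_mul hs0.le, hθ, mul_div_cancel₀ _ hs0.ne', hw,
          ← ENNReal.ofReal_mul hlam.le, ← ENNReal.ofReal_mul (hlam.trans hlu).le]
        exact (ENNReal.ofReal_lt_ofReal_iff (mul_pos (hlam.trans hlu) hside)).2
          (mul_lt_mul_of_pos_right hlu hside)
      exact lt_of_mul_lt_mul_left' (h₁.trans_lt h₂)
    obtain ⟨D, hDQ, hD, hDsum⟩ := exists_cover_of_dyadicContent_lt hsmall
    have hcov : q.set ⊆ ⋃ c ∈ D ∪ {c ∈ C | c.set ⊆ q.set}, c.set := by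
      intro y hy
      rw [biUnion_union]
      by_cases hyO : y ∈ O
      · obtain ⟨c, hc, hyc⟩ := mem_iUnion₂.1 (hOC hyO)
        refine Or.inr (mem_biUnion (x := c) ⟨hc, ?_⟩ hyc)
        rcases le_total c.side q.side with h | h
        · exact Cube.set_subset_of_side_le (hCQ hc) hq h hyc hy
        · exact absurd (mem_biUnion hc
            (Cube.set_subset_of_side_le hq (hCQ hc) h hy hyc hxq)) hxC
      · exact Or.inl (hD ⟨hy, hyO⟩)
    have hle : w q ≤ ENNReal.ofReal θ * w q + ∑' c : {c ∈ C | c.set ⊆ q.set}, w c :=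
      (Cube.ofReal_side_rpow_le_tsum hβ.le hβd q
        ((Q.countable_dyadic.mono hDQ).union (hCc.mono fun c hc => hc.1)) hcov).trans
        ((ENNReal.tsum_union_le w _ _).trans (by gcongr))
    have hfin : ENNReal.ofReal θ * w q ≠ ⊤ :=
      ENNReal.mul_ne_top ENNReal.ofReal_ne_top ENNReal.ofReal_ne_top
    have hone : ENNReal.ofReal (1 - θ) * w q = w q - ENNReal.ofReal θ * w q := by
      rw [ENNReal.ofReal_sub _ hθ0.le, ENNReal.sub_mul fun _ _ => ENNReal.ofReal_ne_top,
        ENNReal.ofReal_one, one_mul]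
    rw [hone]
    exact tsub_le_iff_left.2 hle
  · refine (ENNReal.tsum_union_le w _ _).trans ?_
    have hθ' : ENNReal.ofReal (1 - θ) ≠ 0 := by simpa using hθ1
    refine (ENNReal.mul_le_mul_iff_right hθ' ENNReal.ofReal_ne_top).1 ?_
    calc ENNReal.ofReal (1 - θ) * (∑' c : C, w c + ∑' q : G, w q)
        ≤ ∑' c : C, w c + ∑' c : C, w c := by
          rw [mul_add]
          refine add_le_add (mul_le_of_le_one_left' ?_) hGsum
          rw [← ENNReal.ofReal_one]
          exact ENNReal.ofReal_le_ofReal (by linarith)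
      _ ≤ ENNReal.ofReal ((1 - θ) * δ / 2) + ENNReal.ofReal ((1 - θ) * δ / 2) :=
          add_le_add hCsum.le hCsum.le
      _ = ENNReal.ofReal (1 - θ) * ENNReal.ofReal δ := by
          have := mul_pos (sub_pos.2 hθ1) hδ
          rw [← ENNReal.ofReal_add (by positivity) (by positivity), add_halves,
            ENNReal.ofReal_mul (sub_pos.2 hθ1).le]

end ContentIntegral

theorem calderon_zygmund_content (d : ℕ) (hd : 1 ≤ d) (β : ℝ) (hβ : 0 < β) (hβd : β ≤ (d : ℝ))
    (Q : Cube d) (f : Euc d → ℝ) (hf : MemChoquetL1 (dyadicContent d β Q) Q.set f)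
    (lam : ℝ) (hlam : 0 < lam)
    (hbig : choquetIntegral (dyadicContent d β Q) Q.set (fun x => |f x|) ≤
      ENNReal.ofReal lam * ENNReal.ofReal (Q.side ^ β)) :
    ∃ F : Set (Cube d), F.Countable ∧ (∀ q ∈ F, q ∈ Q.dyadic ∧ q.set ⊆ Q.set) ∧
      (F.Pairwise fun q₁ q₂ => Disjoint (interior q₁.set) (interior q₂.set)) ∧
      (∀ q ∈ F,
        ENNReal.ofReal lam * ENNReal.ofReal (q.side ^ β) <
          choquetIntegral (dyadicContent d β Q) q.set (fun x => |f x|) ∧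
        choquetIntegral (dyadicContent d β Q) q.set (fun x => |f x|) ≤
          ENNReal.ofReal ((2 : ℝ) ^ β * lam) * ENNReal.ofReal (q.side ^ β)) ∧
      (∀ᵐ x ∂(Measure.hausdorffMeasure β : Measure (Euc d)),
        x ∈ Q.set \ (⋃ q ∈ F, q.set) → |f x| ≤ lam) := by
  let P : Set (Cube d) := {q | q ∈ Q.dyadic ∧ q.set ⊆ Q.set ∧ q.side ≤ Q.side ∧
    ENNReal.ofReal lam * ENNReal.ofReal (q.side ^ β) <
      choquetIntegral (dyadicContent d β Q) q.set (fun x => |f x|)}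
  obtain ⟨M, hMP, hMcov, hMdisj, hMmax⟩ := Cube.exists_maximal_subfamily (Q := Q) (P := P)
    (fun q hq => hq.1) (fun q hq => hq.2.2.1)
  refine ⟨M, Q.countable_dyadic.mono fun q hq => (hMP hq).1,
    fun q hq => ⟨(hMP hq).1, (hMP hq).2.1⟩,
    fun q₁ h₁ q₂ h₂ hne => (hMdisj h₁ h₂ hne).mono interior_subset interior_subset,
    fun q hq => ⟨(hMP hq).2.2.2, ?_⟩, ?_⟩
  · obtain ⟨hqd, hqQ, hqs, hqI⟩ := hMP hq
    obtain ⟨p, hp, hps, hqp⟩ := Cube.exists_parent hqd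
    have hpQ : p.side ≤ Q.side := by
      have hlt : q.side < Q.side := lt_of_le_of_ne hqs fun h => by
        have hset : q.set = Q.set := hqQ.antisymm (Cube.set_subset_of_side_le Q.self_mem_dyadic
          hqd h.ge (hqQ q.cornerPoint_mem) q.cornerPoint_mem)
        rw [Cube.eq_of_side_eq_of_set_eq h hset] at hqI
        exact hqI.not_ge hbig
      obtain ⟨n, -, hn, -⟩ := hqd
      have h1 : (2 : ℝ) ^ n < 2 ^ (0 : ℤ) := by
        rw [hn] at hlt
        rw [zpow_zero]
        exact (mul_lt_iff_lt_one_right Q.side_pos).1 hlt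
      have h2 : n + 1 ≤ 0 := (zpow_lt_zpow_iff_right₀ _root_.one_lt_two).1 h1
      have h3 : p.side = Q.side * 2 ^ (n + 1) := by
        rw [hps, hn, zpow_add₀ two_ne_zero]; ring
      rw [h3]
      exact mul_le_of_le_one_right Q.side_pos.le (zpow_le_one_of_nonpos₀ one_le_two h2)
    have hpsub : p.set ⊆ Q.set := Cube.set_subset_of_side_le hp Q.self_mem_dyadic hpQ
      (hqp q.cornerPoint_mem) (hqQ q.cornerPoint_mem)
    have hpI : choquetIntegral (dyadicContent d β Q) p.set (fun x => |f x|) ≤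
        ENNReal.ofReal lam * ENNReal.ofReal (p.side ^ β) := by
      by_contra! h
      have := hMmax q hq p ⟨hp, hpsub, hpQ, h⟩ hqp
      linarith [q.side_pos]
    refine (choquetIntegral_dyadicContent_mono hqp _).trans (hpI.trans_eq ?_)
    rw [hps, Real.mul_rpow zero_le_two q.side_pos.le, ← ENNReal.ofReal_mul hlam.le,
      ← ENNReal.ofReal_mul (by positivity)]
    congr 1
    ring
  · have hnull : ∀ n : ℕ, Measure.hausdorffMeasure β
        {x | x ∈ Q.set \ (⋃ q ∈ M, q.set) ∧ lam + 1 / ((n : ℝ) + 1) < |f x|} = 0 := by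
      intro n
      refine hausdorffMeasure_eq_zero_of_choquetIntegral_le hβ hβd hf.1 hlam
        (lt_add_of_pos_right lam (by positivity)) (fun x hx => hx.2) fun q hq hqs hne => ?_
      obtain ⟨x, hxq, hx, -⟩ := hne
      by_contra! h
      obtain ⟨p, hp, hqp⟩ := hMcov q
        ⟨hq, Cube.set_subset_of_side_le hq Q.self_mem_dyadic hqs hxq hx.1, hqs, h⟩
      exact hx.2 (mem_biUnion hp (hqp hxq))
    refine measure_mono_null (fun x hx => ?_) (measure_iUnion_null hnull)
    simp only [mem_compl_iff, mem_ofPred_eq, Classical.not_imp, not_le] at hx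
    obtain ⟨n, hn⟩ := exists_nat_one_div_lt (sub_pos.2 hx.2)
    exact mem_iUnion.2 ⟨n, hx.1, by linarith⟩

end
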